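/- Let (H_n)_{n∈ℕ} be a sequence of closed subspaces of a complex Hilbert space 𝓗 such that the infinite product ∏_{n∈ℕ} sin(H_n, H_{ℕ∖{n}}) is positive, i.e. there exists δ > 0 with ∏_{n∈s} sin(H_n, H_{ℕ∖{n}}) ≥ δ for every finite subset s ⊂ ℕ, where sin(H_n, H_{ℕ∖{n}}) := inf{ dist(h, M_n) : h ∈ H_n, ‖h‖ = 1 } and M_n is the closed linear span of all H_j with j ≠ n. Then (H_n)_{n∈ℕ} is a Riesz system: there exists a constant C ≥ 1 such that for every choice of unit vectors h_n ∈ H_n and every finitely supported sequence (a_n) of complex numbers, (1/C²) · Σ_n |a_n|² ≤ ‖Σ_n a_n h_n‖² ≤ C² · Σ_n |a_n|². -/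

import Mathlib

open Metric

/-- The closed linear span of all the subspaces `H j` with `j ≠ n`. -/
noncomputable def closedSpanOthers {𝓗 : Type*} [NormedAddCommGroup 𝓗]
    [InnerProductSpace ℂ 𝓗] (H : ℕ → Submodule ℂ 𝓗) (n : ℕ) : Submodule ℂ 𝓗 :=
  (⨆ j ≠ n, H j).topologicalClosure

/-- `sin(H_n, H_{ℕ∖{n}})`: the infimum of the distances of unit vectors of `H n`
to the closed linear span of the other subspaces. -/
noncomputable def sinToOthers {𝓗 : Type*} [NormedAddCommGroup 𝓗]
    [InnerProductSpace ℂ 𝓗] (H : ℕ → Submodule ℂ 𝓗) (n : ℕ) : ℝ :=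
  sInf {r : ℝ | ∃ h : 𝓗, h ∈ H n ∧ ‖h‖ = 1 ∧
    r = infDist h ((closedSpanOthers H n : Submodule ℂ 𝓗) : Set 𝓗)}

open scoped InnerProductSpace MatrixOrder Matrix

open InnerProductSpace in
/-- The determinant of a Gram matrix is the product of the squared norms of the vectors
produced by the Gram-Schmidt process. -/
theorem det_gram_eq_prod_norm_gramSchmidt_sq {𝕜 E ι : Type*} [RCLike 𝕜] [NormedAddCommGroup E]
    [InnerProductSpace 𝕜 E] [LinearOrder ι] [LocallyFiniteOrderBot ι] [WellFoundedLT ι]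
    [Fintype ι] (f : ι → E) :
    (Matrix.gram 𝕜 f).det = ∏ i, ((‖gramSchmidt 𝕜 f i‖ : 𝕜)) ^ 2 := by
  set g := gramSchmidt 𝕜 f with hg
  let T : Matrix ι ι 𝕜 := Matrix.of fun k i ↦
    if k = i then 1 else if k < i then ⟪g k, f i⟫_𝕜 / (‖g k‖ : 𝕜) ^ 2 else 0
  have hT : T.det = 1 := by
    rw [Matrix.det_of_isUpperTriangular]
    · simp [T]
    · intro i j (hij : j < i)
      simp [T, hij.ne', hij.not_gt]
  have hf (i : ι) : f i = ∑ k, T k i • g k := by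
    rw [← Finset.add_sum_erase _ _ (Finset.mem_univ i), gramSchmidt_def'' 𝕜 f i]
    congr 1
    · simp [T, hg]
    · refine Finset.sum_subset_zero_on_sdiff (fun k hk ↦ ?_) (fun k hk ↦ ?_) (fun k hk ↦ ?_)
      · simpa using (Finset.mem_Iio.1 hk).ne
      · simp only [Finset.mem_sdiff, Finset.mem_erase, Finset.mem_univ, and_true,
          Finset.mem_Iio] at hk
        simp [T, hk.1, hk.2]
      · have hk := Finset.mem_Iio.1 hk
        simp [T, hk, hk.ne, ← hg]
  have hgram : Matrix.gram 𝕜 f = Tᴴ * Matrix.diagonal (fun k ↦ (‖g k‖ : 𝕜) ^ 2) * T := by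
    ext i j
    rw [Matrix.gram_apply, hf i, hf j, Matrix.mul_apply, sum_inner]
    refine Finset.sum_congr rfl fun k _ ↦ ?_
    rw [inner_sum, Finset.sum_eq_single k]
    · simp only [inner_smul_left, inner_smul_right, inner_self_eq_norm_sq_to_K,
        Matrix.mul_diagonal, Matrix.conjTranspose_apply, RCLike.star_def]
      ring
    · intro l _ hl
      simp [inner_smul_left, inner_smul_right, hg, gramSchmidt_orthogonal 𝕜 f hl.symm]
    · simp
  rw [hgram]
  simp [Matrix.det_mul, Matrix.det_conjTranspose, hT, Matrix.det_diagonal]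

open InnerProductSpace in
theorem infDist_le_norm_gramSchmidt {𝕜 E ι : Type*} [RCLike 𝕜] [NormedAddCommGroup E]
    [InnerProductSpace 𝕜 E] [LinearOrder ι] [LocallyFiniteOrderBot ι] [WellFoundedLT ι]
    (f : ι → E) (i : ι) (S : Submodule 𝕜 E) (hS : ∀ j < i, f j ∈ S) :
    infDist (f i) (S : Set E) ≤ ‖gramSchmidt 𝕜 f i‖ := by
  have hmem : f i - gramSchmidt 𝕜 f i ∈ S := by
    rw [gramSchmidt_def, sub_sub_cancel]
    refine S.sum_mem fun k hk ↦ ?_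
    rw [Submodule.starProjection_singleton]
    refine S.smul_mem _ (Submodule.span_le.2 ?_ (gramSchmidt_mem_span 𝕜 f le_rfl))
    rintro _ ⟨j, hj, rfl⟩
    exact hS j (lt_of_le_of_lt hj (Finset.mem_Iio.1 hk))
  simpa [dist_eq_norm] using infDist_le_dist_of_mem (x := f i) hmem

/-- Nonnegative numbers with mean `1` and product at least `D > 0` lie between
`D / e` and `e / D`. -/
theorem bounds_of_sum_eq_card_of_le_prod {ι : Type*} [Fintype ι] (x : ι → ℝ)
    (hx : ∀ i, 0 ≤ x i) (hsum : ∑ i, x i = Fintype.card ι) {D : ℝ} (hD : 0 < D)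
    (hprod : D ≤ ∏ i, x i) (i : ι) :
    D / Real.exp 1 ≤ x i ∧ x i ≤ Real.exp 1 / D := by
  classical
  have hothers : ∏ j ∈ Finset.univ.erase i, x j ≤ Real.exp (1 - x i) := by
    calc ∏ j ∈ Finset.univ.erase i, x j
        ≤ ∏ j ∈ Finset.univ.erase i, Real.exp (x j - 1) :=
          Finset.prod_le_prod (fun j _ ↦ hx j) fun j _ ↦ by
            linarith [Real.add_one_le_exp (x j - 1)]
      _ = Real.exp (1 - x i) := by
          rw [← Real.exp_sum]
          congr 1
          have h := Finset.add_sum_erase Finset.univ (fun j ↦ x j - 1) (Finset.mem_univ i)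
          have h' : ∑ j, (x j - 1) = 0 := by simp [Finset.sum_sub_distrib, hsum]
          simp only [h'] at h
          linarith
  have hDx : D ≤ x i * Real.exp (1 - x i) := by
    rw [← Finset.mul_prod_erase _ _ (Finset.mem_univ i)] at hprod
    exact hprod.trans (mul_le_mul_of_nonneg_left hothers (hx i))
  constructor
  · rw [div_le_iff₀ (Real.exp_pos 1)]
    exact hDx.trans (mul_le_mul_of_nonneg_left
      (Real.exp_le_exp.2 (by linarith [hx i])) (hx i))
  · rw [le_div_iff₀ hD]
    have hsq : x i ^ 2 ≤ Real.exp (x i) := by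
      have h := Real.two_mul_le_exp (x := x i / 2)
      have h2 : Real.exp (x i) = Real.exp (x i / 2) ^ 2 := by
        rw [← Real.exp_nat_mul]; congr 1; push_cast; ring
      rw [h2]
      exact pow_le_pow_left₀ (hx i) (by linarith) 2
    calc x i * D ≤ x i * (x i * Real.exp (1 - x i)) := mul_le_mul_of_nonneg_left hDx (hx i)
      _ = x i ^ 2 * Real.exp (1 - x i) := by ring
      _ ≤ Real.exp (x i) * Real.exp (1 - x i) :=
          mul_le_mul_of_nonneg_right hsq (Real.exp_pos _).le
      _ = Real.exp 1 := by rw [← Real.exp_add]; congr 1; ring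

/-- Bounds on the eigenvalues of the Gram matrix of `v` are bounds on the squared norm of
linear combinations of `v`. -/
theorem norm_sum_smul_sq_bounds_of_eigenvalues_gram {𝕜 E ι : Type*} [RCLike 𝕜]
    [NormedAddCommGroup E] [InnerProductSpace 𝕜 E] [Fintype ι] [DecidableEq ι] (v : ι → E)
    {A B : ℝ} (h : ∀ i, A ≤ (Matrix.isHermitian_gram 𝕜 v).eigenvalues i ∧
      (Matrix.isHermitian_gram 𝕜 v).eigenvalues i ≤ B) (a : ι → 𝕜) :
    A * ∑ i, ‖a i‖ ^ 2 ≤ ‖∑ i, a i • v i‖ ^ 2 ∧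
      ‖∑ i, a i • v i‖ ^ 2 ≤ B * ∑ i, ‖a i‖ ^ 2 := by
  have hG := Matrix.isHermitian_gram 𝕜 v
  have hspec : ∀ x ∈ spectrum ℝ (Matrix.gram 𝕜 v), A ≤ x ∧ x ≤ B := by
    rw [hG.spectrum_real_eq_range_eigenvalues]
    rintro _ ⟨i, rfl⟩
    exact h i
  have hquad (r : ℝ) : RCLike.re (star a ⬝ᵥ (algebraMap ℝ (Matrix ι ι 𝕜) r) *ᵥ a) =
      r * ∑ i, ‖a i‖ ^ 2 := by
    rw [Matrix.algebraMap_eq_diagonal, dotProduct, map_sum, Finset.mul_sum]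
    refine Finset.sum_congr rfl fun i _ ↦ ?_
    simp [Matrix.mulVec_diagonal, mul_left_comm _ (r : 𝕜), RCLike.conj_mul]
  have hgram : RCLike.re (star a ⬝ᵥ Matrix.gram 𝕜 v *ᵥ a) = ‖∑ i, a i • v i‖ ^ 2 := by
    rw [Matrix.star_dotProduct_gram_mulVec, inner_self_eq_norm_sq]
  have hmono {P Q : Matrix ι ι 𝕜} (hPQ : P ≤ Q) :
      RCLike.re (star a ⬝ᵥ P *ᵥ a) ≤ RCLike.re (star a ⬝ᵥ Q *ᵥ a) := by
    have := (Matrix.le_iff.1 hPQ).re_dotProduct_nonneg a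
    rwa [Matrix.sub_mulVec, dotProduct_sub, map_sub, sub_nonneg] at this
  rw [← hquad, ← hquad, ← hgram]
  exact ⟨hmono ((algebraMap_le_iff_le_spectrum hG).2 fun x hx ↦ (hspec x hx).1),
    hmono ((le_algebraMap_iff_spectrum_le hG).2 fun x hx ↦ (hspec x hx).2)⟩

theorem norm_sum_smul_sq_bounds_of_le_prod_norm_gramSchmidt {𝕜 E ι : Type*} [RCLike 𝕜]
    [NormedAddCommGroup E] [InnerProductSpace 𝕜 E] [LinearOrder ι] [LocallyFiniteOrderBot ι]
    [WellFoundedLT ι] [Fintype ι] (v : ι → E) (hv : ∀ i, ‖v i‖ = 1) {δ : ℝ} (hδ : 0 < δ)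
    (hprod : δ ≤ ∏ i, ‖InnerProductSpace.gramSchmidt 𝕜 v i‖) (a : ι → 𝕜) :
    δ ^ 2 / Real.exp 1 * ∑ i, ‖a i‖ ^ 2 ≤ ‖∑ i, a i • v i‖ ^ 2 ∧
      ‖∑ i, a i • v i‖ ^ 2 ≤ Real.exp 1 / δ ^ 2 * ∑ i, ‖a i‖ ^ 2 := by
  have hG := Matrix.isHermitian_gram 𝕜 v
  refine norm_sum_smul_sq_bounds_of_eigenvalues_gram v (bounds_of_sum_eq_card_of_le_prod _
    (Matrix.posSemidef_gram 𝕜 v).eigenvalues_nonneg ?_ (by positivity) ?_) a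
  · have h := hG.trace_eq_sum_eigenvalues
    simp only [Matrix.trace, Matrix.diag_apply, Matrix.gram_apply, inner_self_eq_norm_sq_to_K, hv]
      at h
    simp at h
    exact_mod_cast h.symm
  · have h := hG.det_eq_prod_eigenvalues
    rw [det_gram_eq_prod_norm_gramSchmidt_sq] at h
    have h' : ∏ i, ‖InnerProductSpace.gramSchmidt 𝕜 v i‖ ^ 2 = ∏ i, hG.eigenvalues i := by
      exact_mod_cast h
    rw [← h', Finset.prod_pow]
    exact pow_le_pow_left₀ hδ.le hprod 2

theorem sinToOthers_nonneg {𝓗 : Type*} [NormedAddCommGroup 𝓗] [InnerProductSpace ℂ 𝓗]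
    (H : ℕ → Submodule ℂ 𝓗) (n : ℕ) : 0 ≤ sinToOthers H n := by
  refine Real.sInf_nonneg ?_
  rintro _ ⟨h, -, -, rfl⟩
  exact infDist_nonneg

theorem sinToOthers_le_infDist {𝓗 : Type*} [NormedAddCommGroup 𝓗] [InnerProductSpace ℂ 𝓗]
    (H : ℕ → Submodule ℂ 𝓗) {n : ℕ} {h : 𝓗} (hh : h ∈ H n) (hnorm : ‖h‖ = 1) :
    sinToOthers H n ≤ infDist h (closedSpanOthers H n : Set 𝓗) := by
  refine csInf_le ⟨0, ?_⟩ ⟨h, hh, hnorm, rfl⟩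
  rintro _ ⟨h, -, -, rfl⟩
  exact infDist_nonneg

theorem le_closedSpanOthers {𝓗 : Type*} [NormedAddCommGroup 𝓗] [InnerProductSpace ℂ 𝓗]
    (H : ℕ → Submodule ℂ 𝓗) {n j : ℕ} (hj : j ≠ n) : H j ≤ closedSpanOthers H n :=
  (le_iSup₂ (f := fun j (_ : j ≠ n) ↦ H j) j hj).trans (Submodule.le_topologicalClosure _)

/-- if `∏ₙ sin(H_n, H_{ℕ∖{n}}) > 0` then `(H_n)` is a Riesz system. -/
theorem stmt_2 {𝓗 : Type*} [NormedAddCommGroup 𝓗] [InnerProductSpace ℂ 𝓗]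
    [CompleteSpace 𝓗]
    (H : ℕ → Submodule ℂ 𝓗) (hclosed : ∀ n, IsClosed ((H n : Set 𝓗)))
    (hprod : ∃ δ : ℝ, 0 < δ ∧ ∀ s : Finset ℕ, δ ≤ ∏ n ∈ s, sinToOthers H n) :
    ∃ C : ℝ, 1 ≤ C ∧ ∀ h : ℕ → 𝓗, (∀ n, h n ∈ H n) → (∀ n, ‖h n‖ = 1) →
      ∀ (a : ℕ → ℂ) (s : Finset ℕ),
        (1 / C ^ 2) * ∑ n ∈ s, ‖a n‖ ^ 2 ≤ ‖∑ n ∈ s, a n • h n‖ ^ 2 ∧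
        ‖∑ n ∈ s, a n • h n‖ ^ 2 ≤ C ^ 2 * ∑ n ∈ s, ‖a n‖ ^ 2 := by
  obtain ⟨δ, hδ, hprod⟩ := hprod
  have hδ1 : δ ≤ 1 := by simpa using hprod ∅
  refine ⟨Real.exp (1 / 2) / δ, ?_, fun h hmem hnorm a s ↦ ?_⟩
  · rw [one_le_div hδ]
    exact hδ1.trans (Real.one_le_exp (by norm_num))
  have hC : (Real.exp (1 / 2) / δ) ^ 2 = Real.exp 1 / δ ^ 2 := by
    rw [div_pow, ← Real.exp_nat_mul]
    norm_num
  rw [hC, one_div_div]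
  have key := norm_sum_smul_sq_bounds_of_le_prod_norm_gramSchmidt (𝕜 := ℂ)
    (fun i : s ↦ h i) (fun i ↦ hnorm i) hδ ?_ (fun i : s ↦ a i)
  · rwa [Finset.sum_coe_sort s (fun n ↦ ‖a n‖ ^ 2),
      Finset.sum_coe_sort s (fun n ↦ a n • h n)] at key
  calc δ ≤ ∏ n ∈ s, sinToOthers H n := hprod s
    _ = ∏ i : s, sinToOthers H i := (Finset.prod_coe_sort s _).symm
    _ ≤ _ := Finset.prod_le_prod (fun i _ ↦ sinToOthers_nonneg H i) fun i _ ↦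
        (sinToOthers_le_infDist H (hmem i) (hnorm i)).trans
          (infDist_le_norm_gramSchmidt (fun i : s ↦ h i) i _ fun j hj ↦
            le_closedSpanOthers H (fun hji ↦ hj.ne (Subtype.ext hji)) (hmem j))
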